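/- For every integer n ≥ 2, the map sending a Jones normal form datum (l, k, a_1 < … < a_k, b_1 < … < b_k) to the element c^l h^{[b_1,a_1]} ⋯ h^{[b_k,a_k]} of the Kauffman monoid K_n is a bijection from the set of Jones normal form data onto K_n; in particular, every element of K_n has exactly one Jones normal form. -/

import Mathlib

/-!
Kauffman monoid `K n` for `n ≥ 2`: presented by generators `h^1, …, h^{n-1}`
(diapsides) and `c` (circle), subject to
`h^i h^j = h^j h^i` for `|i-j| ≥ 2`, `h^i h^{i±1} h^i = h^i`,
`h^i c = c h^i`, `h^i h^i = c h^i`.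
-/

namespace Kauffman

/-- Valid diapsis indices `1 ≤ i ≤ n-1`. -/
def Idx (n : ℕ) : Type := {i : ℕ // 1 ≤ i ∧ i ≤ n - 1}

/-- Generators of the Kauffman monoid. -/
inductive Gen (n : ℕ) : Type
  | h : Idx n → Gen n
  | c : Gen n

/-- The defining relations of the Kauffman monoid. -/
inductive Rel (n : ℕ) : FreeMonoid (Gen n) → FreeMonoid (Gen n) → Prop
  | comm (i j : Idx n) (hij : i.1 + 2 ≤ j.1 ∨ j.1 + 2 ≤ i.1) :
      Rel n (FreeMonoid.of (Gen.h i) * FreeMonoid.of (Gen.h j))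
            (FreeMonoid.of (Gen.h j) * FreeMonoid.of (Gen.h i))
  | absorb (i j : Idx n) (hij : j.1 = i.1 + 1 ∨ i.1 = j.1 + 1) :
      Rel n (FreeMonoid.of (Gen.h i) * FreeMonoid.of (Gen.h j) * FreeMonoid.of (Gen.h i))
            (FreeMonoid.of (Gen.h i))
  | hc (i : Idx n) :
      Rel n (FreeMonoid.of (Gen.h i) * FreeMonoid.of Gen.c)
            (FreeMonoid.of Gen.c * FreeMonoid.of (Gen.h i))
  | hh (i : Idx n) :
      Rel n (FreeMonoid.of (Gen.h i) * FreeMonoid.of (Gen.h i))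
            (FreeMonoid.of Gen.c * FreeMonoid.of (Gen.h i))

/-- The congruence generated by the Kauffman relations. -/
def kcon (n : ℕ) : Con (FreeMonoid (Gen n)) := conGen (Rel n)

/-- The Kauffman monoid `K n`. -/
abbrev K (n : ℕ) : Type := (kcon n).Quotient

/-- The diapsis `h^i` as an element of `K n` (defined to be `1` for out-of-range `i`). -/
def hK (n i : ℕ) : K n :=
  if h : 1 ≤ i ∧ i ≤ n - 1 then ((FreeMonoid.of (Gen.h ⟨i, h⟩) : FreeMonoid (Gen n)) : K n)
  else 1

/-- The circle `c` as an element of `K n`. -/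
def cK (n : ℕ) : K n := ((FreeMonoid.of Gen.c : FreeMonoid (Gen n)) : K n)

/-- The block `h^{[i,j]} = h^i h^{i-1} ⋯ h^{j+1} h^j` (for `j ≤ i`). -/
def block (n i j : ℕ) : K n :=
  (((List.range (i + 1 - j)).map fun t => hK n (i - t))).prod

end Kauffman

namespace Kauffman

/-- A Jones normal form datum: `l ≥ 0`, `k ≥ 0`, and natural numbers
`a_1 < … < a_k`, `b_1 < … < b_k` with `1 ≤ a_t ≤ b_t ≤ n-1`. -/
structure JonesDatum (n : ℕ) : Type where
  l : ℕ
  k : ℕ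
  a : Fin k → ℕ
  b : Fin k → ℕ
  bounds : ∀ t, 1 ≤ a t ∧ a t ≤ b t ∧ b t ≤ n - 1
  mono_a : StrictMono a
  mono_b : StrictMono b

/-- The element of `K n` associated to a Jones normal form datum:
`c^l h^{[b_1,a_1]} ⋯ h^{[b_k,a_k]}` (interpreted as `1` when `l = k = 0`). -/
def JonesDatum.toK {n : ℕ} (d : JonesDatum n) : K n :=
  (cK n) ^ d.l * (List.ofFn fun t => block n (d.b t) (d.a t)).prod

end Kauffman

namespace Kauffman

section Relations

variable {n : ℕ}

theorem hK_of_mem {i : ℕ} (h : 1 ≤ i ∧ i ≤ n - 1) :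
    hK n i = ((FreeMonoid.of (Gen.h ⟨i, h⟩) : FreeMonoid (Gen n)) : K n) := dif_pos h

theorem coe_eq_coe_of_rel {x y : FreeMonoid (Gen n)} (h : Rel n x y) : (x : K n) = (y : K n) :=
  (Con.eq _).2 (ConGen.Rel.of _ _ h)

theorem hK_commute {i j : ℕ} (hij : i + 2 ≤ j ∨ j + 2 ≤ i) : Commute (hK n i) (hK n j) := by
  by_cases hi : 1 ≤ i ∧ i ≤ n - 1
  · by_cases hj : 1 ≤ j ∧ j ≤ n - 1
    · rw [hK_of_mem hi, hK_of_mem hj]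
      exact coe_eq_coe_of_rel (Rel.comm ⟨i, hi⟩ ⟨j, hj⟩ hij)
    · simp [hK, hj]
  · simp [hK, hi]

theorem hK_absorb {i j : ℕ} (hi : 1 ≤ i ∧ i ≤ n - 1) (hj : 1 ≤ j ∧ j ≤ n - 1)
    (hij : j = i + 1 ∨ i = j + 1) : hK n i * hK n j * hK n i = hK n i := by
  rw [hK_of_mem hi, hK_of_mem hj]
  exact coe_eq_coe_of_rel (Rel.absorb ⟨i, hi⟩ ⟨j, hj⟩ hij)

theorem hK_mul_self {i : ℕ} (hi : 1 ≤ i ∧ i ≤ n - 1) : hK n i * hK n i = cK n * hK n i := by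
  rw [hK_of_mem hi]
  exact coe_eq_coe_of_rel (Rel.hh ⟨i, hi⟩)

theorem cK_commute_coe (g : Gen n) :
    Commute (cK n) ((FreeMonoid.of g : FreeMonoid (Gen n)) : K n) := by
  cases g with
  | h i => exact (coe_eq_coe_of_rel (Rel.hc i)).symm
  | c => exact Commute.refl _

theorem cK_commute (x : K n) : Commute (cK n) x := by
  induction x using Con.induction_on with
  | _ w =>
    induction w using FreeMonoid.inductionOn with
    | one => exact Commute.one_right _
    | of g => exact cK_commute_coe g
    | mul x y hx hy => exact hx.mul_right hy

theorem block_of_lt {i j : ℕ} (h : i < j) : block n i j = 1 := by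
  simp [block, Nat.sub_eq_zero_of_le (Nat.succ_le_of_lt h)]

theorem block_succ {i j : ℕ} (h : j ≤ i + 1) :
    block n (i + 1) j = hK n (i + 1) * block n i j := by
  have e : i + 1 + 1 - j = (i + 1 - j) + 1 := by omega
  simp [block, e, List.range_succ_eq_map, Function.comp_def]

theorem block_self (i : ℕ) : block n i i = hK n i := by
  simp [block]

theorem block_split {b j m : ℕ} (hm : m ≤ j + 1) (hb : j ≤ b) :
    block n b m = block n b (j + 1) * block n j m := by
  induction b, hb using Nat.le_induction with
  | base => simp [block_of_lt (n := n) (Nat.lt_succ_self j)]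
  | succ b hb ih =>
    rw [block_succ (by omega), ih, block_succ (by omega), mul_assoc]

theorem hK_commute_block {i b j : ℕ} (h : b + 2 ≤ i ∨ i + 2 ≤ j) :
    Commute (hK n i) (block n b j) := by
  refine Commute.list_prod_right _ _ fun x hx => ?_
  obtain ⟨t, ht, rfl⟩ := List.mem_map.1 hx
  rw [List.mem_range] at ht
  exact hK_commute (by omega)

theorem block_commute_block {b j b' j' : ℕ} (h : b + 2 ≤ j') :
    Commute (block n b j) (block n b' j') := by
  refine Commute.list_prod_left _ _ fun x hx => ?_
  obtain ⟨t, ht, rfl⟩ := List.mem_map.1 hx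
  exact hK_commute_block (by omega)

theorem hK_mul_block {i b m : ℕ} (hm : 1 ≤ m) (hmi : m ≤ i) (hib : i < b) (hb : b ≤ n - 1) :
    hK n i * block n b m = block n i m * block n b (i + 2) := by
  obtain ⟨q, rfl⟩ : ∃ q, i = q + 1 := ⟨i - 1, by omega⟩
  rw [(block_commute_block (n := n) (le_refl (q + 1 + 2))).eq,
    block_split (j := q + 2) (by omega) (by omega : q + 2 ≤ b), ← mul_assoc,
    (hK_commute_block (by omega) : Commute (hK n (q + 1)) (block n b (q + 2 + 1))).eq,
    block_succ (i := q + 1) (by omega), block_succ (i := q) (by omega), mul_assoc]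
  congr 1
  rw [← mul_assoc, ← mul_assoc, hK_absorb (by omega) (by omega) (by omega)]

theorem block_mul_block {m b q a : ℕ} (hm : 1 ≤ m) (hmq : m ≤ q) (ha : a ≤ q + 1)
    (hqb : q + 1 ≤ b) (hb : b ≤ n - 1) :
    block n b m * block n (q + 1) a = block n (q - 1) m * block n b a := by
  obtain ⟨p, rfl⟩ : ∃ p, q = p + 1 := ⟨q - 1, by omega⟩
  have key : block n b m * hK n (p + 2) = block n p m * block n b (p + 2) := by
    rw [(block_commute_block (n := n) (le_refl (p + 2))).eq,
      block_split (j := p + 1) (by omega) (by omega : p + 1 ≤ b),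
      block_split (j := p + 2) (by omega) hqb, block_self, block_succ (i := p) (by omega)]
    have h1 : Commute (block n p m) (hK n (p + 2)) := (hK_commute_block (by omega)).symm
    have h2 : hK n (p + 2) * hK n (p + 1) * hK n (p + 2) = hK n (p + 2) :=
      hK_absorb (by omega) (by omega) (by omega)
    calc _ = block n b (p + 2 + 1) * (hK n (p + 2) * hK n (p + 1) *
              (block n p m * hK n (p + 2))) := by simp only [mul_assoc]
      _ = block n b (p + 2 + 1) * (hK n (p + 2) * hK n (p + 1) * hK n (p + 2)) *
              block n p m := by rw [h1.eq]; simp only [mul_assoc]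
      _ = _ := by rw [h2]
  rw [block_succ (by omega), ← mul_assoc, key, mul_assoc,
    ← block_split (by omega) (by omega)]
  rfl

end Relations

section Existence

variable {n : ℕ}

/-- `IsNormal n m r x` says that `x` is given by a Jones normal form all of whose lower indices
are at least `m` and all of whose upper indices are at least `r`. -/
inductive IsNormal (n : ℕ) : ℕ → ℕ → K n → Prop
  | circle (m r l : ℕ) : IsNormal n m r (cK n ^ l)
  | cons {m r a b : ℕ} {x : K n} (hm : m ≤ a) (hr : r ≤ b) (hab : a ≤ b) (hb : b ≤ n - 1)
      (hx : IsNormal n (a + 1) (b + 1) x) : IsNormal n m r (block n b a * x)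

theorem IsNormal.anti {m r m' r' : ℕ} {x : K n} (hx : IsNormal n m r x) (hm : m' ≤ m)
    (hr : r' ≤ r) : IsNormal n m' r' x := by
  cases hx with
  | circle => exact .circle _ _ _
  | cons h1 h2 h3 h4 h5 => exact .cons (hm.trans h1) (hr.trans h2) h3 h4 h5

theorem strictMono_cons {k a : ℕ} {f : Fin k → ℕ} (hf : StrictMono f) (ha : ∀ t, a < f t) :
    StrictMono (Fin.cons a f : Fin (k + 1) → ℕ) := by
  intro i j
  refine Fin.cases ?_ (fun i => ?_) i <;> refine Fin.cases ?_ (fun j => ?_) j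
  · exact fun h => absurd h (lt_irrefl _)
  · exact fun _ => ha j
  · exact fun h => absurd h (Fin.not_lt_zero _)
  · exact fun h => hf (Fin.succ_lt_succ_iff.1 h)

theorem IsNormal.exists_datum {m r : ℕ} {x : K n} (hx : IsNormal n m r x) (hm : 1 ≤ m) :
    ∃ d : JonesDatum n, d.toK = x ∧ ∀ t, m ≤ d.a t ∧ r ≤ d.b t := by
  induction hx with
  | circle m r l =>
    exact ⟨⟨l, 0, Fin.elim0, Fin.elim0, fun t => t.elim0, fun t => t.elim0, fun t => t.elim0⟩,
      by simp [JonesDatum.toK], fun t => t.elim0⟩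
  | @cons m r a b x h1 h2 h3 h4 _ ih =>
    obtain ⟨d, rfl, hd⟩ := ih (by omega)
    refine ⟨⟨d.l, d.k + 1, Fin.cons a d.a, Fin.cons b d.b, ?_, ?_, ?_⟩, ?_, ?_⟩
    · intro t
      refine Fin.cases ?_ (fun t => ?_) t
      · simp only [Fin.cons_zero]; omega
      · simpa using d.bounds t
    · exact strictMono_cons d.mono_a fun t => (hd t).1
    · exact strictMono_cons d.mono_b fun t => (hd t).2
    · simp only [JonesDatum.toK, List.ofFn_succ, List.prod_cons, Fin.cons_zero, Fin.cons_succ]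
      rw [← mul_assoc, ((cK_commute _).pow_left _).eq, mul_assoc]
    · intro t
      refine Fin.cases ?_ (fun t => ?_) t
      · exact ⟨h1, h2⟩
      · have := hd t
        simp only [Fin.cons_succ]
        omega

/-- The submonoid generated by the circle and the diapsides `h^i` with `m ≤ i`. -/
def upper (n m : ℕ) : Submonoid (K n) :=
  Submonoid.closure ({cK n} ∪ {x | ∃ i, m ≤ i ∧ i ≤ n - 1 ∧ x = hK n i})

theorem cK_mem_upper (m : ℕ) : cK n ∈ upper n m :=
  Submonoid.subset_closure (Or.inl rfl)

theorem hK_mem_upper {m i : ℕ} (hm : m ≤ i) (hi : i ≤ n - 1) : hK n i ∈ upper n m :=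
  Submonoid.subset_closure (Or.inr ⟨i, hm, hi, rfl⟩)

theorem block_mem_upper {m b a : ℕ} (hm : m ≤ a) (hb : b ≤ n - 1) : block n b a ∈ upper n m := by
  refine Submonoid.list_prod_mem _ fun x hx => ?_
  obtain ⟨t, ht, rfl⟩ := List.mem_map.1 hx
  rw [List.mem_range] at ht
  exact hK_mem_upper (by omega) (by omega)

theorem IsNormal.mem_upper {m r p : ℕ} {x : K n} (hx : IsNormal n m r x) (hp : p ≤ m) :
    x ∈ upper n p := by
  induction hx with
  | circle m r l => exact pow_mem (cK_mem_upper _) _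
  | cons h1 h2 h3 h4 _ ih => exact mul_mem (block_mem_upper (by omega) h4) (ih (by omega))

theorem mem_upper_cases {m : ℕ} (hm : 1 ≤ m) {x : K n} (hx : x ∈ upper n m) :
    x ∈ upper n (m + 1) ∨
      ∃ b, m ≤ b ∧ b ≤ n - 1 ∧ ∃ w ∈ upper n (m + 1), x = block n b m * w := by
  induction hx using Submonoid.closure_induction_left with
  | one => exact Or.inl (one_mem _)
  | mul_left g hg y _ ih =>
    rcases hg with rfl | ⟨i, hmi, hi, rfl⟩
    · rcases ih with hy | ⟨b, hmb, hb, w, hw, rfl⟩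
      · exact Or.inl (mul_mem (cK_mem_upper _) hy)
      · refine Or.inr ⟨b, hmb, hb, cK n * w, mul_mem (cK_mem_upper _) hw, ?_⟩
        rw [← mul_assoc, (cK_commute _).eq, mul_assoc]
    · rcases ih with hy | ⟨b, hmb, hb, w, hw, rfl⟩
      · rcases hmi.eq_or_lt with rfl | hlt
        · exact Or.inr ⟨m, le_rfl, hi, y, hy, by rw [block_self]⟩
        · exact Or.inl (mul_mem (hK_mem_upper hlt hi) hy)
      · right
        rcases lt_trichotomy i b with hib | rfl | hbi
        · refine ⟨i, hmi, hi, block n b (i + 2) * w,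
            mul_mem (block_mem_upper (by omega) hb) hw, ?_⟩
          rw [← mul_assoc, hK_mul_block hm hmi hib hb, mul_assoc]
        · refine ⟨i, hmi, hi, cK n * w, mul_mem (cK_mem_upper _) hw, ?_⟩
          obtain ⟨q, rfl⟩ : ∃ q, i = q + 1 := ⟨i - 1, by omega⟩
          rw [← mul_assoc, ← mul_assoc, ← (cK_commute _).eq, block_succ hmi, ← mul_assoc,
            hK_mul_self ⟨by omega, hi⟩, ← mul_assoc]
        · rcases (Nat.succ_le_of_lt hbi).eq_or_lt with rfl | hlt
          · exact ⟨b + 1, hmi, hi, w, hw, by rw [block_succ (by omega), mul_assoc]⟩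
          · refine ⟨b, hmb, hb, hK n i * w, mul_mem (hK_mem_upper (by omega) hi) hw, ?_⟩
            rw [← mul_assoc, (hK_commute_block (by omega) : Commute _ (block n b m)).eq,
              mul_assoc]

theorem isNormal_block_mul {m : ℕ} (hm : 1 ≤ m)
    (ih : ∀ x ∈ upper n (m + 1), IsNormal n (m + 1) 0 x) (b : ℕ) :
    b ≤ n - 1 → ∀ w ∈ upper n (m + 1), IsNormal n m 0 (block n b m * w) := by
  induction b using Nat.strong_induction_on with
  | _ b ihb =>
    intro hb w hw
    rcases lt_or_ge b m with hbm | hmb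
    · rw [block_of_lt hbm, one_mul]
      exact (ih w hw).anti (Nat.le_succ m) le_rfl
    · cases ih w hw with
      | circle _ _ l => exact .cons le_rfl (Nat.zero_le _) hmb hb (.circle _ _ l)
      | @cons _ _ a b' x h1 _ h3 h4 h5 =>
        rcases lt_or_ge b b' with hlt | hge
        · exact .cons le_rfl (Nat.zero_le _) hmb hb (.cons h1 hlt h3 h4 h5)
        · obtain ⟨q, rfl⟩ : ∃ q, b' = q + 1 := ⟨b' - 1, by omega⟩
          rw [← mul_assoc, block_mul_block hm (by omega) h3 hge hb, mul_assoc]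
          exact ihb _ (by omega) (by omega) _
            (mul_mem (block_mem_upper h1 hb) (h5.mem_upper (by omega)))

theorem isNormal_of_mem_upper (k : ℕ) :
    ∀ m, 1 ≤ m → n ≤ m + k → ∀ x ∈ upper n m, IsNormal n m 0 x := by
  induction k with
  | zero =>
    intro m hm hn x hx
    suffices ∃ l, x = cK n ^ l by
      obtain ⟨l, rfl⟩ := this
      exact .circle _ _ l
    induction hx using Submonoid.closure_induction_left with
    | one => exact ⟨0, (pow_zero _).symm⟩
    | mul_left g hg y _ ih =>
      obtain ⟨l, rfl⟩ := ih
      rcases hg with rfl | ⟨i, hmi, hi, rfl⟩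
      · exact ⟨l + 1, (pow_succ' _ _).symm⟩
      · omega
  | succ k ih =>
    intro m hm hn x hx
    have ih' := ih (m + 1) (by omega) (by omega)
    rcases mem_upper_cases hm hx with hx | ⟨b, _, hb, w, hw, rfl⟩
    · exact (ih' x hx).anti (Nat.le_succ m) le_rfl
    · exact isNormal_block_mul hm ih' b hb w hw

theorem mem_upper_one (x : K n) : x ∈ upper n 1 := by
  induction x using Con.induction_on with
  | _ w =>
    induction w using FreeMonoid.inductionOn with
    | one => exact one_mem _
    | of g =>
      cases g with
      | h i =>
        have := hK_mem_upper i.2.1 i.2.2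
        rwa [hK_of_mem i.2] at this
      | c => exact cK_mem_upper _
    | mul x y hx hy => exact mul_mem hx hy

theorem toK_surjective : Function.Surjective (fun d : JonesDatum n => d.toK) := fun x =>
  let ⟨d, hd, _⟩ := (isNormal_of_mem_upper n 1 le_rfl (by omega) x
    (mem_upper_one x)).exists_datum le_rfl
  ⟨d, hd⟩

end Existence

section Uniqueness

/-- A diagram: a fixed-point-free involution of `ℤ`, pairing the endpoints of threads. The top
endpoint in position `x ≥ 1` is the integer `x`, the bottom one is `1 - x`. -/
def Diagram : Type := {σ : ℤ → ℤ // (∀ x, σ (σ x) = x) ∧ ∀ x, σ x ≠ x}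

/-- The pairing obtained from `σ` by joining the points `p` and `q`, and joining their former
partners with each other. -/
def joinFun (p q : ℤ) (σ : ℤ → ℤ) (x : ℤ) : ℤ :=
  if x = p then q else if x = q then p
  else if x = σ p then σ q else if x = σ q then σ p else σ x

theorem joinFun_comm {p q r s : ℤ} (hpr : p ≠ r) (hps : p ≠ s) (hqr : q ≠ r) (hqs : q ≠ s)
    (hpq : p ≠ q) (hrs : r ≠ s) {σ : ℤ → ℤ} (hσ : ∀ x, σ (σ x) = x) (hσ' : ∀ x, σ x ≠ x) (x : ℤ) :
    joinFun p q (joinFun r s σ) x = joinFun r s (joinFun p q σ) x := by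
  simp only [joinFun, hpr, hps, hqr, hqs, hpr.symm, hps.symm, hqr.symm, hqs.symm, if_false]
  grind (splits := 30)

/-- Stacking the diapsis `h^i` on top of a diagram. -/
def stack (i : ℤ) (σ : Diagram) : Diagram :=
  ⟨joinFun i (i + 1) σ.1, by
    obtain ⟨σ, h1, h2⟩ := σ
    constructor <;> intro x <;> simp only [joinFun] <;> grind⟩

theorem stack_comm {i j : ℤ} (hij : i + 2 ≤ j ∨ j + 2 ≤ i) (σ : Diagram) :
    stack i (stack j σ) = stack j (stack i σ) :=
  Subtype.ext <| funext fun x => joinFun_comm (by omega) (by omega) (by omega) (by omega)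
    (by omega) (by omega) σ.2.1 σ.2.2 x

theorem joinFun_symm (p q : ℤ) (σ : Diagram) (x : ℤ) :
    joinFun p q σ.1 x = joinFun q p σ.1 x := by
  have := σ.2.1 p
  simp only [joinFun]
  grind

theorem joinFun_absorb {p q r : ℤ} (hpr : p ≠ r) (hpq : p ≠ q) (hqr : q ≠ r) {σ : ℤ → ℤ}
    (hσ : ∀ x, σ (σ x) = x) (hσp : σ p = q) (x : ℤ) :
    joinFun p q (joinFun q r σ) x = σ x := by
  have hσq : σ q = p := by rw [← hσp, hσ]
  simp only [joinFun, hpr, hpq, hqr, hpq.symm, hσq, if_true, if_false]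
  grind (splits := 30)

theorem stack_apply_self (i : ℤ) (σ : Diagram) : (stack i σ).1 i = i + 1 := by
  simp [stack, joinFun]

theorem stack_apply_succ (i : ℤ) (σ : Diagram) : (stack i σ).1 (i + 1) = i := by
  simp [stack, joinFun]

theorem stack_absorb {i j : ℤ} (hij : j = i + 1 ∨ i = j + 1) (σ : Diagram) :
    stack i (stack j (stack i σ)) = stack i σ := by
  apply Subtype.ext
  funext x
  have hi := stack_apply_self i σ
  have hi' := stack_apply_succ i σ
  generalize stack i σ = τ at hi hi'
  rcases hij with rfl | rfl
  · exact joinFun_absorb (by omega) (by omega) (by omega) τ.2.1 hi x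
  · have e : (stack j τ).1 = joinFun (j + 1) j τ.1 := funext fun y => joinFun_symm _ _ τ y
    refine (joinFun_symm _ _ (stack j τ) x).trans ?_
    rw [e]
    exact joinFun_absorb (by omega) (by omega) (by omega) τ.2.1 hi' x

theorem stack_self (i : ℤ) (σ : Diagram) : stack i (stack i σ) = stack i σ := by
  obtain ⟨σ, h1, h2⟩ := σ
  apply Subtype.ext
  funext x
  simp only [stack, joinFun]
  grind

theorem end_mul_apply {α : Type*} (f g : Function.End α) (x : α) : (f * g) x = f (g x) := rfl

/-- The action of the diapsis `h^i` on diagrams with a number of circles. -/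
def hAct (i : ℤ) : Function.End (ℕ × Diagram) := fun s =>
  (if s.2.1 i = i + 1 then s.1 + 1 else s.1, stack i s.2)

/-- The action of the circle on diagrams with a number of circles. -/
def cAct : Function.End (ℕ × Diagram) := fun s => (s.1 + 1, s.2)

theorem hAct_comm {i j : ℤ} (hij : i + 2 ≤ j ∨ j + 2 ≤ i) : hAct i * hAct j = hAct j * hAct i := by
  funext ⟨l, σ⟩
  refine Prod.ext ?_ (stack_comm hij σ)
  change (if joinFun j (j + 1) σ.1 i = i + 1 then (if σ.1 j = j + 1 then l + 1 else l) + 1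
      else if σ.1 j = j + 1 then l + 1 else l) =
    if joinFun i (i + 1) σ.1 j = j + 1 then (if σ.1 i = i + 1 then l + 1 else l) + 1
      else if σ.1 i = i + 1 then l + 1 else l
  have := σ.2.1 i
  have := σ.2.1 j
  have := σ.2.1 (i + 1)
  have := σ.2.1 (j + 1)
  generalize σ.1 = σ at *
  simp only [joinFun]
  grind (splits := 30)

theorem hAct_apply_of_ne {i : ℤ} {l : ℕ} {σ : Diagram} (h : σ.1 i ≠ i + 1) :
    hAct i (l, σ) = (l, stack i σ) :=
  Prod.ext (if_neg h) rfl

theorem hAct_absorb {i j : ℤ} (hij : j = i + 1 ∨ i = j + 1) :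
    hAct i * hAct j * hAct i = hAct i := by
  have key (l : ℕ) (τ : Diagram) (hi : τ.1 i = i + 1) (hτ : stack i (stack j τ) = τ) :
      hAct i (hAct j (l, τ)) = (l, τ) := by
    have hi' : τ.1 (i + 1) = i := by rw [← hi, τ.2.1]
    have hj : τ.1 j ≠ j + 1 := by grind
    rw [hAct_apply_of_ne hj, hAct_apply_of_ne, hτ]
    · have := stack_apply_self j τ
      have := stack_apply_succ j τ
      have := (stack j τ).2.1 i
      grind
  funext s
  exact key _ _ (stack_apply_self i s.2) (stack_absorb hij s.2)

theorem hAct_mul_self (i : ℤ) : hAct i * hAct i = cAct * hAct i := by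
  funext s
  exact Prod.ext (if_pos (stack_apply_self i s.2)) (stack_self i s.2)

theorem hAct_mul_cAct (i : ℤ) : hAct i * cAct = cAct * hAct i := by
  funext ⟨l, σ⟩
  refine Prod.ext ?_ rfl
  change (if σ.1 i = i + 1 then l + 1 + 1 else l + 1) = (if σ.1 i = i + 1 then l + 1 else l) + 1
  split_ifs <;> rfl

/-- The action of a generator of the Kauffman monoid on diagrams with a number of circles. -/
def genAct {n : ℕ} : Gen n → Function.End (ℕ × Diagram)
  | .h i => hAct i.1
  | .c => cAct

/-- The action of the Kauffman monoid on diagrams with a number of circles. -/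
def act (n : ℕ) : K n →* Function.End (ℕ × Diagram) :=
  Con.lift (kcon n) (FreeMonoid.lift genAct) <| Con.conGen_le.2 fun x y h => by
    rw [Con.ker_rel]
    cases h with
    | comm i j hij => simpa [genAct] using hAct_comm (by omega)
    | absorb i j hij => simpa [genAct] using hAct_absorb (by omega)
    | hc i => simpa [genAct] using hAct_mul_cAct _
    | hh i => simpa [genAct] using hAct_mul_self _

theorem act_hK {n i : ℕ} (hi : 1 ≤ i ∧ i ≤ n - 1) : act n (hK n i) = hAct i := by
  rw [hK_of_mem hi]
  exact FreeMonoid.lift_eval_of _ _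

theorem act_cK (n : ℕ) : act n (cK n) = cAct :=
  FreeMonoid.lift_eval_of _ _

theorem cAct_pow_apply (m l : ℕ) (σ : Diagram) : (cAct ^ m) (l, σ) = (l + m, σ) := by
  induction m with
  | zero => rfl
  | succ m ih => rw [pow_succ', end_mul_apply, ih]; rfl

/-- The horizontal position of an endpoint. -/
def position (x : ℤ) : ℤ := max x (1 - x)

/-- The partner of the top endpoint in position `x` lies to its left. -/
def TopLeft (σ : Diagram) (x : ℤ) : Prop := 1 ≤ x ∧ position (σ.1 x) < x

/-- The partner of the bottom endpoint in position `x` lies to its right. -/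
def BottomRight (σ : Diagram) (x : ℤ) : Prop := 1 ≤ x ∧ x < position (σ.1 (1 - x))

theorem topLeft_stack_succ {σ : Diagram} {b : ℤ} (hb : 1 ≤ b) (hσ : σ.1 (b + 1) = b)
    (hT : ¬ TopLeft σ (b + 1 + 1)) (x : ℤ) :
    TopLeft (stack (b + 1) σ) x ↔ (TopLeft σ x ∧ x ≠ b + 1) ∨ x = b + 1 + 1 := by
  have h1 := σ.2.1 (b + 1)
  have h2 := σ.2.1 (b + 1 + 1)
  have h3 := σ.2.1 x
  have h4 := σ.2.2 (b + 1 + 1)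
  simp only [TopLeft, position, stack, joinFun] at hT ⊢
  generalize σ.1 = σ at *
  grind

theorem bottomRight_stack_succ {σ : Diagram} {b : ℤ} (hb : 1 ≤ b) (hσ : σ.1 (b + 1) = b)
    (hT : ¬ TopLeft σ (b + 1 + 1)) (x : ℤ) :
    BottomRight (stack (b + 1) σ) x ↔ BottomRight σ x := by
  have h1 := σ.2.1 (b + 1)
  have h2 := σ.2.1 (b + 1 + 1)
  have h3 := σ.2.1 (1 - x)
  have h4 := σ.2.2 (b + 1 + 1)
  simp only [TopLeft, BottomRight, position, stack, joinFun] at hT ⊢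
  generalize σ.1 = σ at *
  grind

theorem act_block {n a b : ℕ} (ha : 1 ≤ a) (hab : a ≤ b) : b ≤ n - 1 → ∀ (l : ℕ) (σ : Diagram),
    σ.1 a = 1 - a → (∀ x ≤ (b : ℤ) + 1, ¬ TopLeft σ x) →
    ∃ τ : Diagram, act n (block n b a) (l, σ) = (l, τ) ∧ τ.1 (b + 1) = b ∧
      (∀ x, TopLeft τ x ↔ TopLeft σ x ∨ x = b + 1) ∧
      (∀ x, BottomRight τ x ↔ BottomRight σ x ∨ x = a) ∧
      ∀ x : ℤ, 1 ≤ x → x < a → σ.1 x = 1 - x → τ.1 x = 1 - x := by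
  induction b, hab using Nat.le_induction with
  | base =>
    intro hn l σ hσ hT
    refine ⟨stack a σ, ?_, ?_, ?_, ?_, ?_⟩
    · rw [block_self, act_hK ⟨ha, hn⟩]
      refine hAct_apply_of_ne ?_
      omega
    · exact stack_apply_succ a σ
    all_goals
      intro x
      have hT' := hT (a + 1) le_rfl
      have h1 := σ.2.1 (a + 1)
      have h2 := σ.2.2 (a + 1)
      have h3 := σ.2.1 x
      have h4 := σ.2.1 (1 - x)
      have h5 := σ.2.1 a
      simp only [TopLeft, BottomRight, position, stack, joinFun] at hT' ⊢
      clear hT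
      generalize σ.1 = σ at *
      grind
  | succ b hab ih =>
    intro hn l σ hσ hT
    obtain ⟨τ, h, hb, hD, hA, hS⟩ := ih (by omega) l σ hσ fun x hx => hT x (by push_cast; omega)
    refine ⟨stack (b + 1) τ, ?_, ?_, ?_, ?_, ?_⟩
    · rw [block_succ (by omega), map_mul, act_hK ⟨by omega, hn⟩, end_mul_apply, h]
      push_cast
      refine hAct_apply_of_ne ?_
      omega
    · exact_mod_cast stack_apply_succ (b + 1) τ
    · intro x
      rw [show ((b + 1 : ℕ) : ℤ) = b + 1 by push_cast; rfl] at *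
      have hx := topLeft_stack_succ (by omega) hb (fun h => ((hD _).1 h).elim
        (hT _ le_rfl) (by omega)) x
      have := hT (b + 1) (by omega)
      rw [hx, hD]
      grind
    · intro x
      rw [← hA]
      refine bottomRight_stack_succ (by omega) hb (fun h => ((hD _).1 h).elim
        (hT _ (by push_cast; omega)) (by omega)) x
    · intro x hx hxa hσx
      have h1 := hS x hx hxa hσx
      have h2 := τ.2.1 x
      have h3 := τ.2.1 (b + 1)
      have h4 := τ.2.1 (b + 1 + 1)
      change joinFun (b + 1) (b + 1 + 1) τ.1 x = 1 - x
      generalize τ.1 = τ at *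
      simp only [joinFun]
      grind

/-- The diagram of the unit, all of whose threads are vertical. -/
def unitDiagram : Diagram := ⟨fun x => 1 - x, fun x => by ring, fun x h => by
  have : 1 - x = x := h
  omega⟩

theorem act_blocks {n k : ℕ} (a b : Fin k → ℕ)
    (bounds : ∀ t, 1 ≤ a t ∧ a t ≤ b t ∧ b t ≤ n - 1) (ha : StrictMono a) (hb : StrictMono b) :
    ∃ τ : Diagram, act n (List.ofFn fun t => block n (b t) (a t)).prod (0, unitDiagram) = (0, τ) ∧
      (∀ x, TopLeft τ x ↔ ∃ t, x = b t + 1) ∧ (∀ x, BottomRight τ x ↔ ∃ t, x = a t) ∧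
      ∀ x : ℤ, 1 ≤ x → (∀ t, x < a t) → τ.1 x = 1 - x := by
  induction k with
  | zero =>
    refine ⟨unitDiagram, by rw [List.ofFn_zero, List.prod_nil, map_one]; rfl, fun x => ?_, fun x => ?_, fun x _ _ => rfl⟩ <;>
      simp only [TopLeft, BottomRight, position, unitDiagram, IsEmpty.exists_iff] <;> grind
  | succ k ih =>
    obtain ⟨σ, h, hD, hA, hS⟩ := ih (fun t => a t.succ) (fun t => b t.succ)
      (fun t => bounds t.succ) (ha.comp (Fin.strictMono_succ)) (hb.comp (Fin.strictMono_succ))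
    have ha' : ∀ t : Fin k, a 0 < a t.succ := fun t => ha t.succ_pos
    have hb' : ∀ t : Fin k, b 0 < b t.succ := fun t => hb t.succ_pos
    obtain ⟨h1, h2, h3⟩ := bounds 0
    obtain ⟨τ, hτ, -, hD', hA', hS'⟩ := act_block h1 h2 h3 0 σ
      (hS _ (by omega) fun t => by have := ha' t; omega) (fun x hx hx' => by
        obtain ⟨t, rfl⟩ := (hD x).1 hx'
        have := hb' t
        omega)
    refine ⟨τ, ?_, fun x => ?_, fun x => ?_, fun x hx hx' => ?_⟩
    · rw [List.ofFn_succ, List.prod_cons, map_mul, end_mul_apply, h, hτ]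
    · rw [hD', hD, Fin.exists_fin_succ, or_comm]
    · rw [hA', hA, Fin.exists_fin_succ, or_comm]
    · exact hS' x hx (hx' 0) (hS x hx fun t => hx' t.succ)

theorem JonesDatum.act_toK {n : ℕ} (d : JonesDatum n) :
    ∃ τ : Diagram, act n d.toK (0, unitDiagram) = (d.l, τ) ∧
      (∀ x, TopLeft τ x ↔ ∃ t, x = d.b t + 1) ∧ (∀ x, BottomRight τ x ↔ ∃ t, x = d.a t) := by
  obtain ⟨τ, h, hD, hA, -⟩ := act_blocks d.a d.b d.bounds d.mono_a d.mono_b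
  refine ⟨τ, ?_, hD, hA⟩
  rw [JonesDatum.toK, map_mul, map_pow, act_cK, end_mul_apply, h,
    cAct_pow_apply, zero_add]

theorem toK_injective {n : ℕ} : Function.Injective (fun d : JonesDatum n => d.toK) := by
  intro d d' hdd
  obtain ⟨τ, h, hD, hA⟩ := d.act_toK
  obtain ⟨τ', h', hD', hA'⟩ := d'.act_toK
  change d.toK = d'.toK at hdd
  rw [hdd, h', Prod.mk.injEq] at h
  obtain ⟨hl, rfl⟩ := h
  have ha : Set.range d.a = Set.range d'.a := by
    ext x
    simpa [eq_comm] using (hA x).symm.trans (hA' x)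
  have hb : Set.range d.b = Set.range d'.b := by
    ext x
    simpa [eq_comm] using (hD (x + 1)).symm.trans (hD' (x + 1))
  have hk : d.k = d'.k := by
    rw [← Nat.card_fin d.k, ← Nat.card_fin d'.k,
      ← Nat.card_range_of_injective d.mono_a.injective,
      ← Nat.card_range_of_injective d'.mono_a.injective, ha]
  obtain ⟨l, k, a, b, _, ma, mb⟩ := d
  obtain ⟨l', k', a', b', _, ma', mb'⟩ := d'
  dsimp only at *
  subst hk hl
  obtain rfl := (ma.range_inj ma').1 ha
  obtain rfl := (mb.range_inj mb').1 hb
  rfl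

end Uniqueness

end Kauffman

open Kauffman in
/-- The map sending a Jones normal form datum to the associated
element of `K n` is a bijection; in particular every element of `K n` has
exactly one Jones normal form. -/
theorem kauffman_jones_normal_form_bijective (n : ℕ) (hn : 2 ≤ n) :
    Function.Bijective (fun d : JonesDatum n => d.toK) := by
  exact ⟨toK_injective, toK_surjective⟩
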